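/- For every real α and every φ ∈ [0, π], μ(α,φ) ≥ 0 and μ(α,φ) ≤ 2π² Sinc²(π²α) + π², where τ(α,φ) = (π-φ)² Sinc²((π-φ)²α/4) - π² Sinc²(π²α/4) and μ(α,φ) = 2π² Sinc²(π²α) + Cos(π²α) τ(α,φ). -/

import Mathlib

noncomputable def RCos (ξ : ℝ) : ℝ := ∑' k : ℕ, (-ξ) ^ k / (Nat.factorial (2 * k))

noncomputable def RSinc (ξ : ℝ) : ℝ := ∑' k : ℕ, (-ξ) ^ k / (Nat.factorial (2 * k + 1))

noncomputable def tau (α φ : ℝ) : ℝ :=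
  (Real.pi - φ) ^ 2 * RSinc ((Real.pi - φ) ^ 2 * α / 4) ^ 2 -
    Real.pi ^ 2 * RSinc (Real.pi ^ 2 * α / 4) ^ 2

noncomputable def mu (α φ : ℝ) : ℝ :=
  2 * Real.pi ^ 2 * RSinc (Real.pi ^ 2 * α) ^ 2 + RCos (Real.pi ^ 2 * α) * tau α φ

theorem RCos_sq (w : ℝ) : RCos (w ^ 2) = Real.cos w := by
  rw [← (Real.hasSum_cos w).tsum_eq, RCos]
  refine tsum_congr fun k => ?_
  rw [neg_pow, pow_mul]

theorem RCos_neg_sq (w : ℝ) : RCos (-w ^ 2) = Real.cosh w := by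
  rw [← (Real.hasSum_cosh w).tsum_eq, RCos]
  refine tsum_congr fun k => ?_
  rw [neg_neg, pow_mul]

theorem RSinc_sq_mul (w : ℝ) : RSinc (w ^ 2) * w = Real.sin w := by
  rw [← (Real.hasSum_sin w).tsum_eq, RSinc, ← tsum_mul_right]
  refine tsum_congr fun k => ?_
  rw [neg_pow, pow_succ w (2 * k), pow_mul]
  ring

theorem RSinc_neg_sq_mul (w : ℝ) : RSinc (-w ^ 2) * w = Real.sinh w := by
  rw [← (Real.hasSum_sinh w).tsum_eq, RSinc, ← tsum_mul_right]
  refine tsum_congr fun k => ?_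
  rw [neg_neg, pow_succ w (2 * k), pow_mul]
  ring

theorem RSinc_zero : RSinc 0 = 1 := by
  rw [RSinc, tsum_eq_single 0 (by intro k hk; simp [hk])]
  simp

theorem RCos_zero : RCos 0 = 1 := by
  simpa using RCos_sq 0

theorem sq_mul_tau_sq (a φ : ℝ) :
    a ^ 2 * tau (a ^ 2) φ =
      2 * (Real.cos (Real.pi * a) - Real.cos ((Real.pi - φ) * a)) := by
  have key (u : ℝ) :
      a ^ 2 * (u ^ 2 * RSinc (u ^ 2 * a ^ 2 / 4) ^ 2) = 2 - 2 * Real.cos (u * a) := by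
    have h := RSinc_sq_mul (u * a / 2)
    rw [show (u * a / 2) ^ 2 = u ^ 2 * a ^ 2 / 4 by ring] at h
    have hc := Real.cos_two_mul (u * a / 2)
    rw [show 2 * (u * a / 2) = u * a by ring] at hc
    have hs := Real.sin_sq_add_cos_sq (u * a / 2)
    rw [← h] at hs
    linear_combination 4 * hs + 2 * hc
  rw [tau]
  linear_combination key (Real.pi - φ) - key Real.pi

theorem sq_mul_tau_neg_sq (a φ : ℝ) :
    a ^ 2 * tau (-a ^ 2) φ =
      2 * (Real.cosh ((Real.pi - φ) * a) - Real.cosh (Real.pi * a)) := by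
  have key (u : ℝ) :
      a ^ 2 * (u ^ 2 * RSinc (u ^ 2 * -a ^ 2 / 4) ^ 2) = 2 * Real.cosh (u * a) - 2 := by
    have h := RSinc_neg_sq_mul (u * a / 2)
    rw [show -(u * a / 2) ^ 2 = u ^ 2 * -a ^ 2 / 4 by ring] at h
    have hc := Real.cosh_two_mul (u * a / 2)
    rw [show 2 * (u * a / 2) = u * a by ring] at hc
    have hs := Real.cosh_sq (u * a / 2)
    rw [← h] at hs hc
    linear_combination -2 * hc - 2 * hs
  rw [tau]
  linear_combination key (Real.pi - φ) - key Real.pi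

theorem sq_mul_mu_sq (a φ : ℝ) :
    a ^ 2 * mu (a ^ 2) φ =
      2 * (1 - Real.cos (Real.pi * a) * Real.cos ((Real.pi - φ) * a)) := by
  have hS := RSinc_sq_mul (Real.pi * a)
  have hs := Real.sin_sq_add_cos_sq (Real.pi * a)
  rw [← hS, mul_pow] at hs
  rw [mu, ← mul_pow, RCos_sq]
  rw [mul_pow] at hs ⊢
  linear_combination 2 * hs + Real.cos (Real.pi * a) * sq_mul_tau_sq a φ

theorem sq_mul_mu_neg_sq (a φ : ℝ) :
    a ^ 2 * mu (-a ^ 2) φ =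
      2 * (Real.cosh (Real.pi * a) * Real.cosh ((Real.pi - φ) * a) - 1) := by
  have hS := RSinc_neg_sq_mul (Real.pi * a)
  have hs := Real.cosh_sq (Real.pi * a)
  rw [← hS] at hs
  rw [mu, show Real.pi ^ 2 * -a ^ 2 = -(Real.pi * a) ^ 2 by ring, RCos_neg_sq]
  linear_combination -2 * hs + Real.cosh (Real.pi * a) * sq_mul_tau_neg_sq a φ

theorem stmt_15 (α φ : ℝ) (hφ : φ ∈ Set.Icc (0 : ℝ) Real.pi) :
    0 ≤ mu α φ ∧ mu α φ ≤ 2 * Real.pi ^ 2 * RSinc (Real.pi ^ 2 * α) ^ 2 + Real.pi ^ 2 := by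
  obtain ⟨h0, hpi⟩ := hφ
  have hsq : (Real.pi - φ) ^ 2 ≤ Real.pi ^ 2 := by nlinarith
  rcases lt_trichotomy α 0 with hα | rfl | hα
  · obtain ⟨a, ha, rfl⟩ : ∃ a : ℝ, 0 < a ∧ α = -a ^ 2 :=
      ⟨√(-α), by simpa using hα, by rw [Real.sq_sqrt (by linarith)]; ring⟩
    have ha2 : 0 < a ^ 2 := by positivity
    constructor
    · refine (mul_nonneg_iff_of_pos_left ha2).1 ?_
      rw [sq_mul_mu_neg_sq]
      nlinarith [Real.one_le_cosh (Real.pi * a), Real.one_le_cosh ((Real.pi - φ) * a)]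
    · have hle : Real.cosh ((Real.pi - φ) * a) ≤ Real.cosh (Real.pi * a) := by
        rw [Real.cosh_le_cosh, abs_of_nonneg (mul_nonneg (by linarith) ha.le),
          abs_of_nonneg (by positivity)]
        gcongr
        linarith
      have htau : tau (-a ^ 2) φ ≤ 0 := by
        refine nonpos_of_mul_nonpos_right (a := a ^ 2) ?_ ha2
        rw [sq_mul_tau_neg_sq]
        linarith
      have hcos : 0 ≤ RCos (Real.pi ^ 2 * -a ^ 2) := by
        rw [show Real.pi ^ 2 * -a ^ 2 = -(Real.pi * a) ^ 2 by ring, RCos_neg_sq]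
        exact (Real.cosh_pos _).le
      rw [mu]
      nlinarith [mul_nonpos_of_nonneg_of_nonpos hcos htau, sq_nonneg Real.pi]
  · simp only [mu, tau, mul_zero, zero_div, RSinc_zero, RCos_zero]
    constructor <;> nlinarith [sq_nonneg (Real.pi - φ), sq_nonneg Real.pi]
  · obtain ⟨a, ha, rfl⟩ : ∃ a : ℝ, 0 < a ∧ α = a ^ 2 :=
      ⟨√α, Real.sqrt_pos.2 hα, (Real.sq_sqrt hα.le).symm⟩
    have ha2 : 0 < a ^ 2 := by positivity
    have hc := Real.abs_cos_le_one (Real.pi * a)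
    constructor
    · refine (mul_nonneg_iff_of_pos_left ha2).1 ?_
      rw [sq_mul_mu_sq]
      have hprod : |Real.cos (Real.pi * a) * Real.cos ((Real.pi - φ) * a)| ≤ 1 := by
        rw [abs_mul]
        exact mul_le_one₀ hc (abs_nonneg _) (Real.abs_cos_le_one _)
      linarith [le_of_abs_le hprod]
    · have hdiff : |Real.cos (Real.pi * a) - Real.cos ((Real.pi - φ) * a)| ≤
          Real.pi ^ 2 * a ^ 2 / 2 := by
        have h1 := Real.one_sub_sq_div_two_le_cos (x := Real.pi * a)
        have h2 := Real.one_sub_sq_div_two_le_cos (x := (Real.pi - φ) * a)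
        rw [mul_pow] at h1 h2
        have h3 := mul_le_mul_of_nonneg_right hsq ha2.le
        rw [abs_le]
        constructor <;>
          linarith [Real.cos_le_one (Real.pi * a), Real.cos_le_one ((Real.pi - φ) * a)]
      have hprod : Real.cos (Real.pi * a) *
          (Real.cos (Real.pi * a) - Real.cos ((Real.pi - φ) * a)) ≤ Real.pi ^ 2 * a ^ 2 / 2 := by
        refine (le_abs_self _).trans ?_
        rw [abs_mul]
        exact (mul_le_of_le_one_left (abs_nonneg _) hc).trans hdiff
      have htau : Real.cos (Real.pi * a) * tau (a ^ 2) φ ≤ Real.pi ^ 2 := by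
        refine le_of_mul_le_mul_left ?_ ha2
        linear_combination 2 * hprod + Real.cos (Real.pi * a) * sq_mul_tau_sq a φ
      rw [mu]
      have hcos : RCos (Real.pi ^ 2 * a ^ 2) = Real.cos (Real.pi * a) := by
        rw [← mul_pow, RCos_sq]
      rw [hcos]
      linarith
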